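/- arXiv:2405.07588 — 3 statements merged into one kernel-verified Lean document; each statement's English description precedes it below -/
import Mathlib

section
/- Every k-degenerate finite graph G satisfies VCdim(G) ≤ k + 1. -/
/-- The closed neighborhood `N[v]` of a vertex `v` in a simple graph. -/
def closedNbhd {V : Type*} (G : SimpleGraph V) (v : V) : Set V :=
  insert v (G.neighborSet v)

/-- A set `X` of vertices is shattered if every subset of `X` is the trace
`N[v] ∩ X` of the closed neighborhood of some vertex `v`. -/
def Shattered {V : Type*} (G : SimpleGraph V) (X : Set V) : Prop :=
  ∀ Y ⊆ X, ∃ v, closedNbhd G v ∩ X = Y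

/-- The VC-dimension of a graph: the maximum cardinality of a shattered set. -/
noncomputable def VCdim {V : Type*} (G : SimpleGraph V) : ℕ :=
  sSup {n | ∃ X : Set V, Shattered G X ∧ X.ncard = n}

/-- A graph is `k`-degenerate if every nonempty (induced) subgraph contains a
vertex with at most `k` neighbors (within that subgraph). -/
def IsDegenerate {V : Type*} (G : SimpleGraph V) (k : ℕ) : Prop :=
  ∀ S : Set V, S.Nonempty → ∃ v ∈ S, (G.neighborSet v ∩ S).ncard ≤ k

theorem mem_closedNbhd_comm {V : Type*} (G : SimpleGraph V) {u v : V} :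
    u ∈ closedNbhd G v ↔ v ∈ closedNbhd G u := by
  simp [closedNbhd, G.adj_comm, eq_comm]

/-- Among the vertices that see at least `|X| - 1` vertices of a shattered set `X`, each `x ∈ X`
has at least `|X|` in its closed neighborhood. -/
theorem Shattered.ncard_le_ncard_closedNbhd_inter {V : Type*} [Finite V] {G : SimpleGraph V}
    {X : Set V} (hX : Shattered G X) {x : V} (hx : x ∈ X) :
    X.ncard ≤ (closedNbhd G x ∩ {v | X.ncard ≤ (closedNbhd G v ∩ X).ncard + 1}).ncard := by
  have h (y : V) : ∃ v, closedNbhd G v ∩ X = X \ ({y} \ {x}) := hX _ Set.sdiff_subset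
  choose f hf using h
  refine Set.ncard_le_ncard_of_injOn f ?_ ?_
  · intro y _
    refine ⟨?_, ?_⟩
    · have hxy : x ∈ closedNbhd G (f y) ∩ X := by simp [hf, hx]
      exact (mem_closedNbhd_comm G).1 hxy.1
    · have hsub : X ⊆ insert y (X \ ({y} \ {x})) := by
        intro z hz
        by_cases hzy : z = y <;> simp [hz, hzy]
      simpa [hf] using (Set.ncard_le_ncard hsub (Set.toFinite _)).trans (Set.ncard_insert_le _ _)
  · intro y hy z hz hyz
    have e : X \ ({y} \ {x}) = X \ ({z} \ {x}) := by rw [← hf, ← hf, hyz]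
    have hy' := Set.ext_iff.1 e y
    have hz' := Set.ext_iff.1 e z
    simp only [Set.mem_sdiff, Set.mem_singleton_iff] at hy' hz'
    grind

theorem ncard_closedNbhd_inter_le {V : Type*} [Finite V] (G : SimpleGraph V) (v : V) (S : Set V) :
    (closedNbhd G v ∩ S).ncard ≤ (G.neighborSet v ∩ S).ncard + 1 := by
  have hsub : closedNbhd G v ∩ S ⊆ insert v (G.neighborSet v ∩ S) := by
    rintro w ⟨rfl | hw, hS⟩
    · exact Set.mem_insert _ _
    · exact Set.mem_insert_of_mem _ ⟨hw, hS⟩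
  exact (Set.ncard_le_ncard hsub (Set.toFinite _)).trans (Set.ncard_insert_le _ _)

theorem Shattered.ncard_le_of_isDegenerate {V : Type*} [Finite V] {G : SimpleGraph V} {k : ℕ}
    (hk : IsDegenerate G k) {X : Set V} (hX : Shattered G X) : X.ncard ≤ k + 1 := by
  rcases X.eq_empty_or_nonempty with rfl | hne
  · simp
  obtain ⟨v, hv, hvk⟩ :=
    hk (X ∪ {v | X.ncard ≤ (closedNbhd G v ∩ X).ncard + 1}) (hne.mono Set.subset_union_left)
  by_cases hvX : v ∈ X
  · calc X.ncard
        ≤ (closedNbhd G v ∩ {v | X.ncard ≤ (closedNbhd G v ∩ X).ncard + 1}).ncard :=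
          hX.ncard_le_ncard_closedNbhd_inter hvX
      _ ≤ (closedNbhd G v ∩ (X ∪ {v | X.ncard ≤ (closedNbhd G v ∩ X).ncard + 1})).ncard :=
          Set.ncard_le_ncard (Set.inter_subset_inter_right _ Set.subset_union_right)
            (Set.toFinite _)
      _ ≤ k + 1 := (ncard_closedNbhd_inter_le G v _).trans (by lia)
  · have hdeg : X.ncard ≤ (closedNbhd G v ∩ X).ncard + 1 := hv.resolve_left hvX
    have htrace : closedNbhd G v ∩ X = G.neighborSet v ∩ X := Set.insert_inter_of_notMem hvX
    rw [htrace] at hdeg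
    have hle := Set.ncard_le_ncard (Set.inter_subset_inter_right (G.neighborSet v)
      (Set.subset_union_left (s := X) (t := {v | X.ncard ≤ (closedNbhd G v ∩ X).ncard + 1})))
      (Set.toFinite _)
    lia

theorem stmt_4 {V : Type*} [Fintype V] (G : SimpleGraph V) (k : ℕ)
    (hk : IsDegenerate G k) : VCdim G ≤ k + 1 := by
  refine csSup_le' ?_
  rintro _ ⟨X, hX, rfl⟩
  exact hX.ncard_le_of_isDegenerate hk
end

section
/- Let G = (V, E) be a finite graph with at least one edge, and let M be a maximal matching of G. Then VCdim(G) ≤ 2|M|. -/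
/-- A matching: a set of edges of `G` that are pairwise vertex-disjoint. -/
def IsMatchingSet {V : Type*} (G : SimpleGraph V) (M : Set (Sym2 V)) : Prop :=
  M ⊆ G.edgeSet ∧ ∀ e ∈ M, ∀ f ∈ M, e ≠ f → ∀ v : V, ¬(v ∈ e ∧ v ∈ f)

/-- A matching is maximal if no edge of `G` can be added to it while keeping
it a matching. -/
def MaximalMatchingSet {V : Type*} (G : SimpleGraph V) (M : Set (Sym2 V)) : Prop :=
  IsMatchingSet G M ∧ ∀ e ∈ G.edgeSet, e ∉ M → ¬ IsMatchingSet G (insert e M)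

/-- The set of vertices covered by a set of edges. -/
def coveredVerts {V : Type*} (M : Set (Sym2 V)) : Set V :=
  {v | ∃ e ∈ M, v ∈ e}

theorem ncard_coveredVerts_le {V : Type*} [Finite V] (M : Set (Sym2 V)) :
    (coveredVerts M).ncard ≤ 2 * M.ncard := by
  classical
  have := Fintype.ofFinite V
  have hC : coveredVerts M = ↑(M.toFinset.biUnion Sym2.toFinset) := by
    ext v
    simp [coveredVerts]
  rw [hC, Set.ncard_coe_finset, Set.ncard_eq_toFinset_card', mul_comm]
  refine Finset.card_biUnion_le_card_mul _ _ _ fun e _ => ?_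
  rw [Sym2.card_toFinset]
  split_ifs <;> omega

theorem MaximalMatchingSet.mem_coveredVerts_of_adj {V : Type*} {G : SimpleGraph V}
    {M : Set (Sym2 V)} (hM : MaximalMatchingSet G M) {u v : V} (huv : G.Adj u v) :
    u ∈ coveredVerts M ∨ v ∈ coveredVerts M := by
  by_contra! ⟨hu, hv⟩
  have disjoint : ∀ f ∈ M, ∀ w ∈ s(u, v), w ∉ f := by
    intro f hf w hw hwf
    rcases Sym2.mem_iff.mp hw with rfl | rfl
    · exact hu ⟨f, hf, hwf⟩
    · exact hv ⟨f, hf, hwf⟩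
  refine hM.2 s(u, v) huv (fun h => hu ⟨_, h, Sym2.mem_mk_left u v⟩)
    ⟨Set.insert_subset huv hM.1.1, ?_⟩
  rintro e (rfl | he) f (rfl | hf) hne w ⟨hwe, hwf⟩
  · exact hne rfl
  · exact disjoint f hf w hwe hwf
  · exact disjoint e he w hwf hwe
  · exact hM.1.2 e he f hf hne w ⟨hwe, hwf⟩

theorem MaximalMatchingSet.nonempty {V : Type*} {G : SimpleGraph V} {M : Set (Sym2 V)}
    (hM : MaximalMatchingSet G M) (hE : G.edgeSet.Nonempty) : M.Nonempty := by
  obtain ⟨e, he⟩ := hE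
  induction e using Sym2.ind with
  | _ u v =>
    rcases hM.mem_coveredVerts_of_adj he with ⟨f, hf, -⟩ | ⟨f, hf, -⟩ <;> exact ⟨f, hf⟩

theorem Shattered.two_pow_le_ncard_closedNbhd {V : Type*} [Finite V] {G : SimpleGraph V}
    {X : Set V} (hX : Shattered G X) {x : V} (hx : x ∈ X) :
    2 ^ (X.ncard - 1) ≤ (closedNbhd G x).ncard := by
  rw [← Set.ncard_sdiff_singleton_of_mem hx, ← Set.ncard_powerset _]
  have hsub : 𝒫 (X \ {x}) ⊆ (fun v => (closedNbhd G v ∩ X) \ {x}) '' closedNbhd G x := by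
    intro Y hY
    obtain ⟨v, hv⟩ := hX (insert x Y) (Set.insert_subset hx fun y hy => (hY hy).1)
    have hxv : x ∈ closedNbhd G v := (hv.symm ▸ Set.mem_insert x Y : x ∈ closedNbhd G v ∩ X).1
    refine ⟨v, ?_, ?_⟩
    · rcases hxv with rfl | h
      · exact Set.mem_insert _ _
      · exact Set.mem_insert_of_mem _ (G.adj_symm h)
    · simp only [hv]
      exact Set.insert_sdiff_self_of_notMem fun h => (hY h).2 rfl
  exact (Set.ncard_le_ncard hsub).trans (Set.ncard_image_le (Set.toFinite _))

theorem Shattered.ncard_le_two_mul_ncard {V : Type*} [Finite V] {G : SimpleGraph V}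
    {X : Set V} (hX : Shattered G X) (hE : G.edgeSet.Nonempty) {M : Set (Sym2 V)}
    (hM : MaximalMatchingSet G M) : X.ncard ≤ 2 * M.ncard := by
  by_contra! hlt
  have hC := ncard_coveredVerts_le M
  obtain ⟨x, hx, hxC⟩ := Set.exists_mem_notMem_of_ncard_lt_ncard (hC.trans_lt hlt)
  have hN : closedNbhd G x ⊆ insert x (coveredVerts M) :=
    Set.insert_subset_insert fun v hv => (hM.mem_coveredVerts_of_adj hv).resolve_left hxC
  have hpow : 2 ^ (X.ncard - 1) ≤ 2 * M.ncard + 1 :=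
    (hX.two_pow_le_ncard_closedNbhd hx).trans <| (Set.ncard_le_ncard hN).trans <|
      (Set.ncard_insert_le _ _).trans (by omega)
  have hpos : 0 < M.ncard := (Set.ncard_pos).mpr (hM.nonempty hE)
  have hexp : 2 ^ (2 * M.ncard) ≤ 2 ^ (X.ncard - 1) :=
    Nat.pow_le_pow_right two_pos (by omega)
  have hlin : 2 * M.ncard - 1 < 2 ^ (2 * M.ncard - 1) := Nat.lt_two_pow_self
  have hdouble : 2 ^ (2 * M.ncard) = 2 * 2 ^ (2 * M.ncard - 1) := by
    rw [← pow_succ']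
    congr 1
    omega
  omega

theorem stmt_5 {V : Type*} [Fintype V] (G : SimpleGraph V)
    (hE : G.edgeSet.Nonempty) (M : Set (Sym2 V))
    (hM : MaximalMatchingSet G M) :
    VCdim G ≤ 2 * M.ncard := by
  refine csSup_le' ?_
  rintro _ ⟨X, hX, rfl⟩
  exact hX.ncard_le_two_mul_ncard hE hM
end

section
/- Let G = (V, E) be a finite graph with at least one edge, and let ν(G) be the size of a maximum matching in G. Then VCdim(G) ≤ ν(G) + 1. Equivalently, for every shattered set X ⊆ V there exists a matching in G of size at least |X| − 1. -/
/-- Numerical form of Hall's condition for a shattered set of size `s + k`. -/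
lemma two_pow_add_le_two_pow_add {s k : ℕ} (hs : 1 ≤ s) (hk : 1 ≤ k) (hsk : 3 ≤ s + k) :
    2 ^ k + (2 * s + k) ≤ 2 ^ (s + k) := by
  have ha : k + 1 ≤ 2 ^ k := Nat.lt_two_pow_self
  rcases hs.eq_or_lt with rfl | hs
  · obtain ⟨j, rfl⟩ : ∃ j, k = j + 2 := ⟨k - 2, by omega⟩
    have hj : j + 1 ≤ 2 ^ j := Nat.lt_two_pow_self
    rw [show 1 + (j + 2) = j + 3 by ring, pow_add, pow_add]
    omega
  · obtain ⟨j, rfl⟩ : ∃ j, s = j + 2 := ⟨s - 2, by omega⟩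
    have hj : j + 1 ≤ 2 ^ j := Nat.lt_two_pow_self
    rw [pow_add 2 (j + 2) k, pow_add 2 j 2]
    have h : (j + 3 + 1) * 2 ^ k ≤ (2 ^ j * 2 ^ 2) * 2 ^ k :=
      Nat.mul_le_mul_right _ (by omega)
    have h' : (j + 3) * (k + 1) ≤ (j + 3) * 2 ^ k := Nat.mul_le_mul_left _ ha
    have h'' : j ≤ j * k := Nat.le_mul_of_pos_right _ hk
    nlinarith

open Finset in
/-- In a shattered set `X`, the vertices outside `X` adjacent to some element of a subset `S` are
at least as many as the subsets of `X` meeting `S`, up to an error of `#X`. -/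
lemma Shattered.two_pow_le_card_biUnion {V : Type*} [Fintype V] [DecidableEq V]
    {G : SimpleGraph V} [DecidableRel G.Adj] {X S : Finset V}
    (hX : Shattered G (X : Set V)) (hS : S ⊆ X) :
    2 ^ #X ≤ 2 ^ (#X - #S) + #(S.biUnion fun x => {v | v ∉ X ∧ G.Adj x v}) + #X := by
  have hw : ∀ Y : Finset V, ∃ v, Y ⊆ X → closedNbhd G v ∩ X = Y := by
    intro Y
    by_cases hY : Y ⊆ X
    · obtain ⟨v, hv⟩ := hX Y (by exact_mod_cast hY)
      exact ⟨v, fun _ => hv⟩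
    · exact (hX ∅ (Set.empty_subset _)).imp fun v _ h => absurd h hY
  choose w hw using hw
  have hinj : Set.InjOn w (X.powerset \ (X \ S).powerset : Finset (Finset V)) := by
    intro Y hY Z hZ h
    simp only [coe_sdiff, Set.mem_sdiff, mem_coe, mem_powerset] at hY hZ
    have hYZ := hw Y hY.1
    rw [h, hw Z hZ.1] at hYZ
    exact_mod_cast hYZ.symm
  have hsub : (X.powerset \ (X \ S).powerset).image w ⊆
      S.biUnion (fun x => ({v | v ∉ X ∧ G.Adj x v} : Finset V)) ∪ X := by
    intro v hv
    obtain ⟨Y, hY, rfl⟩ := mem_image.1 hv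
    simp only [mem_sdiff, mem_powerset] at hY
    obtain ⟨hYX, hYS⟩ := hY
    by_cases hvX : w Y ∈ X
    · exact mem_union_right _ hvX
    obtain ⟨x, hxY, hx⟩ := not_subset.1 hYS
    have hxX := hYX hxY
    have hxS : x ∈ S := by simpa [hxX] using hx
    have hxw : x ∈ closedNbhd G (w Y) :=
      Set.inter_subset_left (show x ∈ closedNbhd G (w Y) ∩ X from (hw Y hYX).symm ▸ hxY)
    refine mem_union_left _ (mem_biUnion.2 ⟨x, hxS, ?_⟩)
    rcases hxw with rfl | hadj
    · exact absurd hxX hvX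
    · simpa [hvX] using hadj.symm
  have hcard := (card_le_card hsub).trans (card_union_le _ _)
  rw [card_image_of_injOn hinj, card_sdiff_of_subset (powerset_mono.2 sdiff_subset),
    card_powerset, card_powerset, card_sdiff_of_subset hS] at hcard
  omega

open Finset in
/-- If `f` injectively assigns to each vertex of `S` a neighbor outside `X ⊇ S`, the edges
`s(x, f x)` form a matching of size `#S`. -/
lemma exists_isMatchingSet_of_injective {V : Type*} {G : SimpleGraph V} {X S : Finset V}
    (hS : S ⊆ X) {f : S → V} (hf : f.Injective) (hfX : ∀ x, f x ∉ X)
    (hadj : ∀ x : S, G.Adj x (f x)) : ∃ M, IsMatchingSet G M ∧ M.ncard = #S := by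
  have hne : ∀ x y : S, (x : V) ≠ f y := fun x y h => hfX y (h ▸ hS x.2)
  refine ⟨Set.range fun x : S => s((x : V), f x), ⟨?_, ?_⟩, ?_⟩
  · rintro _ ⟨x, rfl⟩
    exact hadj x
  · rintro _ ⟨x, rfl⟩ _ ⟨y, rfl⟩ hxy v ⟨hx, hy⟩
    apply hxy
    suffices x = y by rw [this]
    rcases Sym2.mem_iff.1 hx with rfl | rfl <;> rcases Sym2.mem_iff.1 hy with h | h
    · exact Subtype.ext h
    · exact absurd h (hne x y)
    · exact absurd h.symm (hne y x)
    · exact hf h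
  · rw [← Set.image_univ, Set.ncard_image_of_injective, Set.ncard_univ, Nat.card_eq_fintype_card,
      Fintype.card_coe]
    intro x y h
    rcases Sym2.eq_iff.1 h with h | h
    · exact Subtype.ext h.1
    · exact absurd h.1 (hne x y)

open Finset in
lemma Shattered.exists_isMatchingSet_of_three_le {V : Type*} [Fintype V] {G : SimpleGraph V}
    {X : Finset V} (hX : Shattered G (X : Set V)) (hcard : 3 ≤ #X) :
    ∃ M, IsMatchingSet G M ∧ M.ncard = #X - 1 := by
  classical
  obtain ⟨a, ha⟩ : X.Nonempty := card_pos.1 (by omega)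
  let t : X.erase a → Finset V := fun x => {v | v ∉ X ∧ G.Adj x v}
  have hall : ∀ s : Finset (X.erase a), #s ≤ #(s.biUnion t) := by
    intro s
    rcases s.eq_empty_or_nonempty with rfl | hs
    · simp
    have hsX : s.map (Function.Embedding.subtype _) ⊆ X.erase a := by
      intro v hv
      obtain ⟨x, -, rfl⟩ := mem_map.1 hv
      exact x.2
    have hle := card_le_card hsX
    rw [card_map, card_erase_of_mem ha] at hle
    have h := hX.two_pow_le_card_biUnion (hsX.trans (erase_subset _ _))
    rw [card_map, map_eq_image, image_biUnion] at h
    have hs' := hs.card_pos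
    have h' := two_pow_add_le_two_pow_add (s := #s) (k := #X - #s)
      (by omega) (by omega) (by omega)
    rw [Nat.add_sub_cancel' (by omega)] at h'
    change _ ≤ _ + #(s.biUnion t) + _ at h
    omega
  obtain ⟨f, hf, hft⟩ := (all_card_le_biUnion_card_iff_exists_injective t).1 hall
  have hmem : ∀ x, f x ∉ X ∧ G.Adj x (f x) := fun x => by simpa [t] using hft x
  rw [← card_erase_of_mem ha]
  exact exists_isMatchingSet_of_injective (erase_subset _ _) hf (fun x => (hmem x).1)
    fun x => (hmem x).2

lemma Shattered.exists_isMatchingSet {V : Type*} [Fintype V] {G : SimpleGraph V}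
    (hE : G.edgeSet.Nonempty) {X : Set V} (hX : Shattered G X) :
    ∃ M, IsMatchingSet G M ∧ X.ncard - 1 ≤ M.ncard := by
  lift X to Finset V using X.toFinite
  rw [Set.ncard_coe_finset]
  by_cases hcard : 3 ≤ X.card
  · obtain ⟨M, hM, h⟩ := hX.exists_isMatchingSet_of_three_le hcard
    exact ⟨M, hM, h.ge⟩
  · obtain ⟨e, he⟩ := hE
    refine ⟨{e}, ⟨Set.singleton_subset_iff.2 he, ?_⟩, ?_⟩
    · rintro _ rfl _ rfl h
      exact absurd rfl h
    · rw [Set.ncard_singleton]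
      omega

theorem stmt_6 {V : Type*} [Fintype V] (G : SimpleGraph V)
    (hE : G.edgeSet.Nonempty) (ν : ℕ)
    (hν : IsGreatest {n | ∃ M : Set (Sym2 V), IsMatchingSet G M ∧ M.ncard = n} ν) :
    VCdim G ≤ ν + 1 ∧
      ∀ X : Set V, Shattered G X →
        ∃ M : Set (Sym2 V), IsMatchingSet G M ∧ X.ncard - 1 ≤ M.ncard := by
  have hmatch : ∀ X : Set V, Shattered G X →
      ∃ M : Set (Sym2 V), IsMatchingSet G M ∧ X.ncard - 1 ≤ M.ncard :=
    fun _ hX => hX.exists_isMatchingSet hE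
  refine ⟨csSup_le' ?_, hmatch⟩
  rintro _ ⟨X, hX, rfl⟩
  obtain ⟨M, hM, hle⟩ := hmatch X hX
  have hMν : M.ncard ≤ ν := hν.2 ⟨M, hM, rfl⟩
  omega
end
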